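/- Let Ω⁺ ⊂ ℝ³ be a non-empty bounded open set and let λ > |Ω⁺|. Then the constrained minimization problem min{ E(Ω⁻) : Ω⁻ ⊂ ℝ³ measurable, |Ω⁺ ∩ Ω⁻| = 0, |Ω⁻| = λ } has no global minimizer: for every admissible set Ω⁻ with |Ω⁻| = λ there exists another admissible set Ω̃⁻ with |Ω̃⁻| = λ and E(Ω̃⁻) < E(Ω⁻). -/

import Mathlib

open MeasureTheory Real

noncomputable section

abbrev E3 := EuclideanSpace ℝ (Fin 3)

/-- The Coulomb kernel in ℝ³. -/
def coul (x y : E3) : ℝ := 1 / (4 * π * ‖x - y‖)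

/-- The Coulomb energy `E(Ω⁻)` of a negative phase `Ωm` in the field of the
positive phase `Ωp`. -/
def energy (Ωp Ωm : Set E3) : ℝ :=
  (∫ x in Ωp, ∫ y in Ωp, coul x y) + (∫ x in Ωm, ∫ y in Ωm, coul x y)
    - 2 * ∫ x in Ωp, ∫ y in Ωm, coul x y

/-- Admissible configurations for the constrained problem with volume `λ`. -/
def AdmC (Ωp : Set E3) (lam : ℝ) (Ωm : Set E3) : Prop :=
  MeasurableSet Ωm ∧ volume (Ωp ∩ Ωm) = 0 ∧ volume Ωm = ENNReal.ofReal lam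

open Set Filter Topology

/-- The Coulomb potential of a uniformly charged set. -/
def coulombPotential (A : Set E3) (x : E3) : ℝ := ∫ y in A, coul x y

theorem coul_comm (x y : E3) : coul x y = coul y x := by
  rw [coul, coul, norm_sub_rev]

theorem coul_nonneg (x y : E3) : 0 ≤ coul x y := by
  unfold coul; positivity

theorem coul_le_inv_norm (x y : E3) : coul x y ≤ ‖x - y‖⁻¹ := by
  have h : coul x y = (4 * π)⁻¹ * ‖x - y‖⁻¹ := by
    rw [coul, one_div, mul_inv]
  rw [h]
  have h4 : (4 * π)⁻¹ ≤ 1 := inv_le_one_of_one_le₀ (by nlinarith [pi_gt_three])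
  exact mul_le_of_le_one_left (by positivity) h4

theorem measurable_coul : Measurable (Function.uncurry coul) := by
  unfold coul Function.uncurry
  fun_prop

theorem measurable_coul_right (x : E3) : Measurable (coul x) := by
  unfold coul
  fun_prop

/-- `‖x - y‖⁻²` is integrable over sets of finite measure, uniformly in `x`. -/
theorem exists_integral_inv_sq_le :
    ∃ C : ℝ, 0 ≤ C ∧ ∀ (x : E3) (A : Set E3), volume A ≠ ⊤ →
      IntegrableOn (fun y ↦ ‖x - y‖⁻¹ ^ 2) A ∧
        ∫ y in A, ‖x - y‖⁻¹ ^ 2 ≤ C + volume.real A := by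
  have hball : IntegrableOn (fun y : E3 ↦ ‖y‖⁻¹ ^ 2) (Metric.ball 0 1) := by
    refine integrableOn_ball_of_norm_le_rpow (C := 1) (α := 2) (by simp) (by simp; norm_num) ?_ ?_
    · refine Eventually.of_forall fun y ↦ ?_
      rw [norm_of_nonneg (by positivity), one_mul, rpow_neg (norm_nonneg _), inv_pow]
      norm_num
    · exact (Measurable.aestronglyMeasurable (by fun_prop))
  set g : E3 → ℝ := (Metric.ball (0 : E3) 1).indicator (fun y ↦ ‖y‖⁻¹ ^ 2) with hg
  have hgi : Integrable g := (integrable_indicator_iff measurableSet_ball).2 hball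
  have hg0 : ∀ y, 0 ≤ g y := fun y ↦ indicator_nonneg (fun _ _ ↦ by positivity) y
  refine ⟨∫ y, g y, integral_nonneg hg0, fun x A hA ↦ ?_⟩
  have hgx : Integrable (fun y ↦ g (x - y)) := hgi.comp_sub_left x
  have hfin : IsFiniteMeasure (volume.restrict A) := ⟨by simpa using hA.lt_top⟩
  have hsum : IntegrableOn (fun y ↦ g (x - y) + 1) A := hgx.integrableOn.add (integrable_const _)
  have hle : ∀ y : E3, ‖x - y‖⁻¹ ^ 2 ≤ g (x - y) + 1 := by
    intro y
    by_cases h : x - y ∈ Metric.ball (0 : E3) 1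
    · rw [hg, indicator_of_mem h]; linarith
    · rw [hg, indicator_of_notMem h, zero_add]
      have h1 : 1 ≤ ‖x - y‖ := by simpa using h
      exact pow_le_one₀ (by positivity) (inv_le_one_of_one_le₀ h1)
  have h_int : IntegrableOn (fun y ↦ ‖x - y‖⁻¹ ^ 2) A := by
    refine hsum.mono' (Measurable.aestronglyMeasurable (by fun_prop)) ?_
    exact Eventually.of_forall fun y ↦ by rw [norm_of_nonneg (by positivity)]; exact hle y
  refine ⟨h_int, ?_⟩
  calc ∫ y in A, ‖x - y‖⁻¹ ^ 2 ≤ ∫ y in A, (g (x - y) + 1) := integral_mono h_int hsum hle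
    _ = (∫ y in A, g (x - y)) + volume.real A := by
        rw [integral_add hgx.integrableOn (integrable_const _)]; simp [measureReal_def]
    _ ≤ (∫ y, g (x - y)) + volume.real A := by
        gcongr
        · exact Eventually.of_forall fun y ↦ hg0 _
        · exact Measure.restrict_le_self
    _ = _ := by rw [integral_sub_left_eq_self]

theorem integrableOn_coul {A : Set E3} (hA : volume A ≠ ⊤) (x : E3) : IntegrableOn (coul x) A := by
  obtain ⟨C, -, h⟩ := exists_integral_inv_sq_le
  have hfin : IsFiniteMeasure (volume.restrict A) := ⟨by simpa using hA.lt_top⟩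
  refine ((h x A hA).1.add (integrable_const (1 : ℝ))).mono'
    (measurable_coul_right x).aestronglyMeasurable (Eventually.of_forall fun y ↦ ?_)
  rw [norm_of_nonneg (coul_nonneg _ _)]
  refine (coul_le_inv_norm x y).trans ?_
  simp only [Pi.add_apply]
  nlinarith [sq_nonneg (‖x - y‖⁻¹ - 1), sq_nonneg (‖x - y‖⁻¹)]

theorem coulombPotential_nonneg (A : Set E3) (x : E3) : 0 ≤ coulombPotential A x :=
  integral_nonneg fun _ ↦ coul_nonneg _ _

theorem exists_coulombPotential_le :
    ∃ C : ℝ, 0 ≤ C ∧ ∀ (t : ℝ), 0 < t → ∀ (x : E3) (A : Set E3), volume A ≠ ⊤ →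
      coulombPotential A x ≤ t * (C + volume.real A) + t⁻¹ * volume.real A := by
  obtain ⟨C, hC, h⟩ := exists_integral_inv_sq_le
  refine ⟨C, hC, fun t ht x A hA ↦ ?_⟩
  have hfin : IsFiniteMeasure (volume.restrict A) := ⟨by simpa using hA.lt_top⟩
  have h1 := ((h x A hA).1.const_mul t)
  calc coulombPotential A x ≤ ∫ y in A, (t * ‖x - y‖⁻¹ ^ 2 + t⁻¹) := by
        refine integral_mono (integrableOn_coul hA x) (h1.add (integrable_const _)) fun y ↦ ?_
        refine (coul_le_inv_norm x y).trans ?_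
        have : t * ‖x - y‖⁻¹ ^ 2 + t⁻¹ - ‖x - y‖⁻¹
            = t * (‖x - y‖⁻¹ - t⁻¹ / 2) ^ 2 + 3 / 4 * t⁻¹ := by
          field_simp; ring
        have h2 : 0 ≤ t * (‖x - y‖⁻¹ - t⁻¹ / 2) ^ 2 + 3 / 4 * t⁻¹ := by positivity
        linarith
    _ = t * (∫ y in A, ‖x - y‖⁻¹ ^ 2) + t⁻¹ * volume.real A := by
        rw [integral_add h1 (integrable_const _), integral_const_mul]
        simp [measureReal_def, mul_comm]
    _ ≤ _ := by gcongr; exact (h x A hA).2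

/-- Sets of small measure have uniformly small potential. -/
theorem exists_coulombPotential_lt {κ : ℝ} (hκ : 0 < κ) :
    ∃ a : ℝ, 0 < a ∧ ∀ (x : E3) (A : Set E3), volume A ≤ ENNReal.ofReal a →
      coulombPotential A x ≤ κ := by
  obtain ⟨C, hC, h⟩ := exists_coulombPotential_le
  set t := κ / (2 * (C + 1)) with ht
  have ht0 : 0 < t := by positivity
  refine ⟨min 1 (t * κ / 2), by positivity, fun x A hA ↦ ?_⟩
  have hfin : volume A ≠ ⊤ := ne_top_of_le_ne_top ENNReal.ofReal_ne_top hA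
  have hv : volume.real A ≤ min 1 (t * κ / 2) :=
    ENNReal.toReal_le_of_le_ofReal (by positivity) hA
  refine (h t ht0 x A hfin).trans ?_
  have h1 : t * (C + volume.real A) ≤ t * (C + 1) := by
    gcongr; exact hv.trans (min_le_left _ _)
  have h2 : t⁻¹ * volume.real A ≤ t⁻¹ * (t * κ / 2) := by
    gcongr; exact hv.trans (min_le_right _ _)
  have h3 : t⁻¹ * (t * κ / 2) = κ / 2 := by field_simp
  have h4 : t * (C + 1) = κ / 2 := by rw [ht]; field_simp
  linarith

theorem ae_restrict_ne (A : Set E3) (x : E3) : ∀ᵐ y ∂(volume.restrict A), y ≠ x := by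
  refine ae_restrict_of_ae ?_
  simp [ae_iff]

theorem exists_lipschitz_coulombPotential {A : Set E3} (hA : volume A ≠ ⊤) :
    ∃ L : ℝ, 0 ≤ L ∧ ∀ x x' : E3,
      |coulombPotential A x - coulombPotential A x'| ≤ L * ‖x - x'‖ := by
  obtain ⟨C, hC, h⟩ := exists_integral_inv_sq_le
  refine ⟨2 * (C + volume.real A), by positivity, fun x x' ↦ ?_⟩
  have hi := integrableOn_coul hA
  rw [coulombPotential, coulombPotential, ← integral_sub (hi x) (hi x')]
  have hw := ((h x A hA).1.add (h x' A hA).1).const_mul ‖x - x'‖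
  calc |∫ y in A, (coul x y - coul x' y)| ≤ ∫ y in A, |coul x y - coul x' y| :=
        abs_integral_le_integral_abs
    _ ≤ ∫ y in A, ‖x - x'‖ * (‖x - y‖⁻¹ ^ 2 + ‖x' - y‖⁻¹ ^ 2) := by
        refine integral_mono_ae ((hi x).sub (hi x')).abs hw ?_
        filter_upwards [ae_restrict_ne A x, ae_restrict_ne A x'] with y hy hy'
        have ha : 0 < ‖x - y‖ := norm_pos_iff.2 (sub_ne_zero.2 hy.symm)
        have hb : 0 < ‖x' - y‖ := norm_pos_iff.2 (sub_ne_zero.2 hy'.symm)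
        have hd : |‖x' - y‖ - ‖x - y‖| ≤ ‖x - x'‖ := by
          have := abs_norm_sub_norm_le (x' - y) (x - y)
          rwa [sub_sub_sub_cancel_right, norm_sub_rev x' x] at this
        have e : coul x y - coul x' y = (4 * π)⁻¹ *
            ((‖x' - y‖ - ‖x - y‖) * (‖x - y‖⁻¹ * ‖x' - y‖⁻¹)) := by
          simp only [coul]; field_simp
        have h4 : (4 * π)⁻¹ ≤ 1 := inv_le_one_of_one_le₀ (by nlinarith [pi_gt_three])
        rw [e, abs_mul, abs_mul, abs_of_pos (by positivity : 0 < (4 * π)⁻¹),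
          abs_of_pos (by positivity : 0 < ‖x - y‖⁻¹ * ‖x' - y‖⁻¹)]
        refine (mul_le_of_le_one_left (by positivity) h4).trans ?_
        refine mul_le_mul hd ?_ (by positivity) (norm_nonneg _)
        nlinarith [sq_nonneg (‖x - y‖⁻¹ - ‖x' - y‖⁻¹), sq_nonneg (‖x - y‖⁻¹ + ‖x' - y‖⁻¹)]
    _ ≤ _ := by
        rw [integral_const_mul, integral_add (h x A hA).1 (h x' A hA).1]
        have h1 := (h x A hA).2
        have h2 := (h x' A hA).2
        rw [mul_comm]
        gcongr
        linarith

theorem continuous_coulombPotential {A : Set E3} (hA : volume A ≠ ⊤) :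
    Continuous (coulombPotential A) := by
  obtain ⟨L, hL, h⟩ := exists_lipschitz_coulombPotential hA
  refine (LipschitzWith.of_dist_le_mul (K := ⟨L, hL⟩) fun x x' ↦ ?_).continuous
  rw [dist_eq_norm, dist_eq_norm]
  exact h x x'

theorem exists_coulombPotential_bound {A : Set E3} (hA : volume A ≠ ⊤) :
    ∃ M : ℝ, ∀ x, coulombPotential A x ≤ M := by
  obtain ⟨C, hC, h⟩ := exists_coulombPotential_le
  exact ⟨_, fun x ↦ h 1 one_pos x A hA⟩

theorem integrableOn_coulombPotential {A B : Set E3} (hA : volume A ≠ ⊤) (hB : volume B ≠ ⊤) :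
    IntegrableOn (coulombPotential A) B := by
  obtain ⟨M, hM⟩ := exists_coulombPotential_bound hA
  have hfin : IsFiniteMeasure (volume.restrict B) := ⟨by simpa using hB.lt_top⟩
  refine Integrable.of_bound (C := M) (continuous_coulombPotential hA).aestronglyMeasurable
    (Eventually.of_forall fun x ↦ ?_)
  rw [norm_of_nonneg (coulombPotential_nonneg _ _)]
  exact hM x

theorem integral_coulombPotential_comm {A B : Set E3} (hA : volume A ≠ ⊤) (hB : volume B ≠ ⊤) :
    ∫ x in A, coulombPotential B x = ∫ x in B, coulombPotential A x := by
  have hfA : IsFiniteMeasure (volume.restrict A) := ⟨by simpa using hA.lt_top⟩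
  have hfB : IsFiniteMeasure (volume.restrict B) := ⟨by simpa using hB.lt_top⟩
  have h_int : Integrable (Function.uncurry coul)
      ((volume.restrict A).prod (volume.restrict B)) := by
    rw [integrable_prod_iff measurable_coul.aestronglyMeasurable]
    refine ⟨Eventually.of_forall fun x ↦ integrableOn_coul hB x, ?_⟩
    refine (integrableOn_coulombPotential hB hA).congr (Eventually.of_forall fun x ↦ ?_)
    refine integral_congr_ae (Eventually.of_forall fun y ↦ ?_)
    exact (norm_of_nonneg (coul_nonneg x y)).symm
  simp only [coulombPotential]
  rw [integral_integral_swap h_int]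
  simp_rw [coul_comm]

theorem coulombPotential_union {A B : Set E3} (hA : volume A ≠ ⊤) (hB : volume B ≠ ⊤)
    (hd : Disjoint A B) (hmB : MeasurableSet B) (x : E3) :
    coulombPotential (A ∪ B) x = coulombPotential A x + coulombPotential B x :=
  setIntegral_union hd hmB (integrableOn_coul hA x) (integrableOn_coul hB x)

/-- The potential of a set of finite measure vanishes at infinity. -/
theorem exists_coulombPotential_le_of_norm_ge {A : Set E3} (hm : MeasurableSet A)
    (hA : volume A ≠ ⊤) {κ : ℝ} (hκ : 0 < κ) :
    ∃ R : ℝ, 0 < R ∧ ∀ x : E3, R ≤ ‖x‖ → coulombPotential A x ≤ κ := by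
  obtain ⟨a, ha, hsmall⟩ := exists_coulombPotential_lt (half_pos hκ)
  have htend : Tendsto (fun n : ℕ ↦ volume (A \ Metric.ball (0 : E3) n)) atTop (𝓝 0) := by
    have := tendsto_measure_iInter_atTop (μ := volume)
      (s := fun n : ℕ ↦ A \ Metric.ball (0 : E3) n)
      (fun n ↦ (hm.diff measurableSet_ball).nullMeasurableSet)
      (fun i j hij ↦ sdiff_subset_sdiff_right (Metric.ball_subset_ball (by exact_mod_cast hij)))
      ⟨0, ne_top_of_le_ne_top hA (measure_mono sdiff_subset)⟩
    have he : ⋂ n : ℕ, A \ Metric.ball (0 : E3) n = ∅ := by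
      rw [← sdiff_iUnion, Metric.iUnion_ball_nat, sdiff_univ]
    rwa [he, measure_empty] at this
  obtain ⟨n, hn⟩ := (htend.eventually_le_const
    (ENNReal.ofReal_pos.2 ha : 0 < ENNReal.ofReal a)).exists
  set v := volume.real A
  have hv : 0 ≤ v := measureReal_nonneg
  refine ⟨n + 1 + 2 * v / κ, by positivity, fun x hx ↦ ?_⟩
  have hAn : volume (A ∩ Metric.ball (0 : E3) n) ≠ ⊤ :=
    ne_top_of_le_ne_top hA (measure_mono inter_subset_left)
  have hAd : volume (A \ Metric.ball (0 : E3) n) ≠ ⊤ :=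
    ne_top_of_le_ne_top hA (measure_mono sdiff_subset)
  have hsplit := coulombPotential_union hAn hAd
    (disjoint_sdiff_right.mono_left inter_subset_right) (hm.diff measurableSet_ball) x
  rw [inter_union_sdiff] at hsplit
  have h1 := hsmall x _ hn
  have hfin : IsFiniteMeasure (volume.restrict (A ∩ Metric.ball (0 : E3) n)) :=
    ⟨by simpa using hAn.lt_top⟩
  have h2 : coulombPotential (A ∩ Metric.ball (0 : E3) n) x ≤ κ / 2 := by
    have hpos : 0 < 1 + 2 * v / κ := by positivity
    calc coulombPotential (A ∩ Metric.ball (0 : E3) n) x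
        ≤ ∫ y in A ∩ Metric.ball (0 : E3) n, (1 + 2 * v / κ)⁻¹ := by
          refine setIntegral_mono_on (integrableOn_coul hAn x) (integrable_const _)
            (hm.inter measurableSet_ball) fun y hy ↦ (coul_le_inv_norm x y).trans ?_
          have hy' : ‖y‖ < n := by simpa using hy.2
          have := norm_sub_norm_le x y
          gcongr
          linarith
      _ = volume.real (A ∩ Metric.ball (0 : E3) n) * (1 + 2 * v / κ)⁻¹ := by
          simp [measureReal_def]
      _ ≤ v * (1 + 2 * v / κ)⁻¹ := by
          gcongr
          exact measureReal_mono inter_subset_left hA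
      _ ≤ κ / 2 := by
          rw [← div_eq_mul_inv, div_le_iff₀ hpos]
          field_simp
          linarith
  linarith

/-- A measurable set has subsets of every smaller volume. -/
theorem exists_measurable_subset_volume_eq {T : Set E3} (hT : MeasurableSet T) {a : ℝ}
    (ha : 0 ≤ a) (haT : ENNReal.ofReal a < volume T) :
    ∃ B ⊆ T, MeasurableSet B ∧ volume B = ENNReal.ofReal a := by
  set f : ℝ → ℝ := fun R ↦ volume.real (T ∩ Metric.ball (0 : E3) R) with hf
  have hfin : ∀ R, volume (T ∩ Metric.ball (0 : E3) R) ≠ ⊤ := fun R ↦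
    ne_top_of_le_ne_top measure_ball_lt_top.ne (measure_mono inter_subset_right)
  have hdiff : ∀ R S : ℝ, 0 ≤ R → R ≤ S →
      f S - f R ≤ (S ^ 3 - R ^ 3) * volume.real (Metric.ball (0 : E3) 1) := by
    intro R S hR hRS
    have hv : ∀ r : ℝ, 0 ≤ r → volume.real (Metric.ball (0 : E3) r)
        = r ^ 3 * volume.real (Metric.ball (0 : E3) 1) := by
      intro r hr
      rw [measureReal_def, Measure.addHaar_ball _ _ hr, ENNReal.toReal_mul,
        ENNReal.toReal_ofReal (by positivity), measureReal_def]
      simp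
    have hb := Metric.ball_subset_ball (x := (0 : E3)) hRS
    have e1 : f S - f R = volume.real ((T ∩ Metric.ball (0 : E3) S) \ Metric.ball 0 R) := by
      have := measureReal_sdiff_add_inter (μ := volume) (s := T ∩ Metric.ball (0 : E3) S)
        (t := Metric.ball 0 R) measurableSet_ball (hfin S)
      rw [inter_assoc, inter_eq_self_of_subset_right hb] at this
      simp only [hf]
      linarith
    have e2 : volume.real (Metric.ball (0 : E3) S \ Metric.ball 0 R)
        = (S ^ 3 - R ^ 3) * volume.real (Metric.ball (0 : E3) 1) := by
      rw [measureReal_sdiff hb measurableSet_ball, hv S (hR.trans hRS), hv R hR]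
      ring
    rw [e1, ← e2]
    exact measureReal_mono (sdiff_subset_sdiff_left inter_subset_right)
      (ne_top_of_le_ne_top measure_ball_lt_top.ne (measure_mono sdiff_subset))
  have hmono : Monotone f := fun R S hRS ↦ measureReal_mono
    (inter_subset_inter_right _ (Metric.ball_subset_ball hRS)) (hfin S)
  have hcont : ContinuousOn f (Ici 0) := by
    intro R hR
    set g : ℝ → ℝ := fun S ↦ |S ^ 3 - R ^ 3| * volume.real (Metric.ball (0 : E3) 1) with hg
    have hgc : Continuous g := by fun_prop
    have hgt : Tendsto g (𝓝[Ici 0] R) (𝓝 0) := by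
      have : g R = 0 := by simp [hg]
      rw [← this]
      exact hgc.continuousWithinAt
    refine tendsto_iff_dist_tendsto_zero.2 (squeeze_zero' (Eventually.of_forall fun _ ↦ dist_nonneg)
      ?_ hgt)
    filter_upwards [self_mem_nhdsWithin] with S hS
    have hvol : 0 ≤ volume.real (Metric.ball (0 : E3) 1) := measureReal_nonneg
    rw [Real.dist_eq]
    rcases le_total R S with h | h
    · rw [abs_of_nonneg (sub_nonneg.2 (hmono h))]
      refine (hdiff R S hR h).trans ?_
      exact mul_le_mul_of_nonneg_right (le_abs_self _) hvol
    · rw [abs_sub_comm, abs_of_nonneg (sub_nonneg.2 (hmono h)), hg]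
      simp only
      rw [abs_sub_comm]
      refine (hdiff S R hS h).trans ?_
      exact mul_le_mul_of_nonneg_right (le_abs_self _) hvol
  obtain ⟨n, hn⟩ : ∃ n : ℕ, ENNReal.ofReal a < volume (T ∩ Metric.ball (0 : E3) n) := by
    have ht := tendsto_measure_iUnion_atTop (μ := volume)
      (s := fun n : ℕ ↦ T ∩ Metric.ball (0 : E3) n)
      (fun i j hij ↦ inter_subset_inter_right _ (Metric.ball_subset_ball (by exact_mod_cast hij)))
    rw [← inter_iUnion, Metric.iUnion_ball_nat, inter_univ] at ht
    exact (ht.eventually (lt_mem_nhds haT)).exists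
  have h0 : f 0 = 0 := by simp [hf]
  have hn' : a ≤ f n := by
    exact (ENNReal.ofReal_le_iff_le_toReal (hfin _)).1 hn.le
  obtain ⟨R, hR, hRa⟩ := intermediate_value_Icc (n.cast_nonneg (α := ℝ))
    (hcont.mono Icc_subset_Ici_self) ⟨by rw [h0]; exact ha, hn'⟩
  refine ⟨T ∩ Metric.ball 0 R, inter_subset_left, hT.inter measurableSet_ball, ?_⟩
  rw [← hRa, hf]
  exact (ofReal_measureReal (hfin R)).symm

/-- The regularised distance `√(‖x - y‖² + η²)`. -/
def softDist (η : ℝ) (x y : E3) : ℝ := √(‖x - y‖ ^ 2 + η ^ 2)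

/-- The regularised Coulomb kernel. -/
def softCoul (η : ℝ) (x y : E3) : ℝ := (4 * π)⁻¹ * (softDist η x y)⁻¹

/-- The derivative of `softCoul` in direction `e`. -/
def softCoulDeriv (η : ℝ) (e x y : E3) : ℝ :=
  (4 * π)⁻¹ * (-(inner ℝ (x - y) e) * (softDist η x y)⁻¹ ^ 3)

/-- The second derivative of `softCoul` in the direction of the unit vector `e`. -/
def softCoulDeriv2 (η : ℝ) (e x y : E3) : ℝ :=
  (4 * π)⁻¹ * (3 * inner ℝ (x - y) e ^ 2 * (softDist η x y)⁻¹ ^ 5 - (softDist η x y)⁻¹ ^ 3)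

theorem four_pi_inv_le : (4 * π)⁻¹ ≤ 1 / 3 := by
  rw [one_div]
  exact inv_anti₀ (by norm_num) (by nlinarith [pi_gt_three])

theorem continuous_softDist (η : ℝ) : Continuous (Function.uncurry (softDist η)) := by
  unfold softDist Function.uncurry
  fun_prop

theorem le_softDist {η : ℝ} (x y : E3) : η ≤ softDist η x y :=
  le_sqrt_of_sq_le (by nlinarith [sq_nonneg ‖x - y‖])

theorem norm_le_softDist {η : ℝ} (x y : E3) : ‖x - y‖ ≤ softDist η x y :=
  le_sqrt_of_sq_le (by nlinarith [sq_nonneg η])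

theorem softDist_pos {η : ℝ} (hη : 0 < η) (x y : E3) : 0 < softDist η x y :=
  hη.trans_le (le_softDist x y)

theorem inv_softDist_le {η : ℝ} (hη : 0 < η) (x y : E3) : (softDist η x y)⁻¹ ≤ η⁻¹ :=
  inv_anti₀ hη (le_softDist x y)

theorem sq_softDist (η : ℝ) (x y : E3) : softDist η x y ^ 2 = ‖x - y‖ ^ 2 + η ^ 2 :=
  sq_sqrt (by positivity)

theorem continuous_softCoul {η : ℝ} (hη : 0 < η) : Continuous (Function.uncurry (softCoul η)) :=
  continuous_const.mul ((continuous_softDist η).inv₀ fun p ↦ (softDist_pos hη p.1 p.2).ne')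

theorem continuous_softCoulDeriv {η : ℝ} (hη : 0 < η) (e : E3) :
    Continuous (Function.uncurry (softCoulDeriv η e)) := by
  have h := (continuous_softDist η).inv₀ fun p ↦ (softDist_pos hη p.1 p.2).ne'
  have h1 : Continuous fun p : E3 × E3 ↦ inner ℝ (p.1 - p.2) e := by fun_prop
  exact continuous_const.mul (h1.neg.mul (h.pow 3))

theorem continuous_softCoulDeriv2 {η : ℝ} (hη : 0 < η) (e : E3) :
    Continuous (Function.uncurry (softCoulDeriv2 η e)) := by
  have h := (continuous_softDist η).inv₀ fun p ↦ (softDist_pos hη p.1 p.2).ne'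
  have h1 : Continuous fun p : E3 × E3 ↦ inner ℝ (p.1 - p.2) e := by fun_prop
  exact continuous_const.mul (((continuous_const.mul (h1.pow 2)).mul (h.pow 5)).sub (h.pow 3))

theorem abs_softCoul_le {η : ℝ} (hη : 0 < η) (x y : E3) : |softCoul η x y| ≤ η⁻¹ := by
  have h := inv_softDist_le hη x y
  have h0 := inv_pos.2 (softDist_pos hη x y)
  have hp : 0 < (4 * π)⁻¹ := by positivity
  rw [softCoul, abs_of_pos (by positivity)]
  nlinarith [four_pi_inv_le]

theorem abs_inner_mul_inv_softDist_le {η : ℝ} (hη : 0 < η) {e : E3} (he : ‖e‖ = 1) (x y : E3) :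
    |inner ℝ (x - y) e| * (softDist η x y)⁻¹ ≤ 1 := by
  have h0 := softDist_pos hη x y
  rw [← div_eq_mul_inv, div_le_one h0]
  refine (abs_real_inner_le_norm _ _).trans ?_
  rw [he, mul_one]
  exact norm_le_softDist x y

theorem abs_softCoulDeriv_le {η : ℝ} (hη : 0 < η) {e : E3} (he : ‖e‖ = 1) (x y : E3) :
    |softCoulDeriv η e x y| ≤ η⁻¹ ^ 2 := by
  have h := inv_softDist_le hη x y
  have h0 := inv_pos.2 (softDist_pos hη x y)
  have hp : 0 < (4 * π)⁻¹ := by positivity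
  rw [softCoulDeriv, abs_mul, abs_mul, abs_neg, abs_of_pos hp,
    abs_of_pos (pow_pos h0 3)]
  calc (4 * π)⁻¹ * (|inner ℝ (x - y) e| * (softDist η x y)⁻¹ ^ 3)
      = (4 * π)⁻¹ * ((|inner ℝ (x - y) e| * (softDist η x y)⁻¹) * (softDist η x y)⁻¹ ^ 2) := by
        ring
    _ ≤ 1 * (1 * η⁻¹ ^ 2) := by
        gcongr
        · linarith [four_pi_inv_le]
        · exact abs_inner_mul_inv_softDist_le hη he x y
    _ = _ := by ring

theorem abs_softCoulDeriv2_le {η : ℝ} (hη : 0 < η) {e : E3} (he : ‖e‖ = 1) (x y : E3) :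
    |softCoulDeriv2 η e x y| ≤ 2 * η⁻¹ ^ 3 := by
  have h := inv_softDist_le hη x y
  have h0 := inv_pos.2 (softDist_pos hη x y)
  have hp : 0 < (4 * π)⁻¹ := by positivity
  have h1 := abs_inner_mul_inv_softDist_le hη he x y
  rw [softCoulDeriv2, abs_mul, abs_of_pos hp]
  calc (4 * π)⁻¹ *
        |3 * inner ℝ (x - y) e ^ 2 * (softDist η x y)⁻¹ ^ 5 - (softDist η x y)⁻¹ ^ 3|
      ≤ 1 / 3 * (|3 * inner ℝ (x - y) e ^ 2 * (softDist η x y)⁻¹ ^ 5|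
          + |(softDist η x y)⁻¹ ^ 3|) := by
        gcongr
        · exact four_pi_inv_le
        · exact abs_sub _ _
    _ = 1 / 3 * (3 * (|inner ℝ (x - y) e| * (softDist η x y)⁻¹) ^ 2 * (softDist η x y)⁻¹ ^ 3
          + (softDist η x y)⁻¹ ^ 3) := by
        rw [abs_of_nonneg (by positivity), abs_of_nonneg (by positivity), mul_pow, sq_abs]
        ring
    _ ≤ 1 / 3 * (3 * 1 ^ 2 * η⁻¹ ^ 3 + η⁻¹ ^ 3) := by gcongr
    _ ≤ _ := by nlinarith [pow_pos (inv_pos.2 hη) 3]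

theorem hasDerivAt_inner_line (e x : E3) (he : ‖e‖ = 1) (y : E3) (t : ℝ) :
    HasDerivAt (fun t : ℝ ↦ inner ℝ (x + t • e - y) e) 1 t := by
  have h : (fun t : ℝ ↦ inner ℝ (x + t • e - y) e) = fun t ↦ inner ℝ (x - y) e + t := by
    funext s
    rw [add_sub_right_comm, inner_add_left, real_inner_smul_left, real_inner_self_eq_norm_sq, he]
    ring
  rw [h]
  exact (hasDerivAt_id t).const_add _

theorem hasDerivAt_line (e x : E3) (t : ℝ) : HasDerivAt (fun t : ℝ ↦ x + t • e) e t := by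
  simpa using ((hasDerivAt_id t).smul_const e).const_add x

theorem hasDerivAt_inv_softDist {η : ℝ} (hη : 0 < η) (e x y : E3) (t : ℝ) :
    HasDerivAt (fun t : ℝ ↦ (softDist η (x + t • e) y)⁻¹)
      (-(inner ℝ (x + t • e - y) e) * (softDist η (x + t • e) y)⁻¹ ^ 3) t := by
  have h0 := softDist_pos hη (x + t • e) y
  have h1 := (((hasDerivAt_line e x t).sub_const y).norm_sq.add_const (η ^ 2)).sqrt
    (by positivity)
  refine HasDerivAt.congr_deriv (h1.inv h0.ne') ?_
  change -(_ / (2 * softDist η (x + t • e) y)) / softDist η (x + t • e) y ^ 2 = _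
  field_simp

theorem hasDerivAt_softCoul {η : ℝ} (hη : 0 < η) (e x y : E3) (t : ℝ) :
    HasDerivAt (fun t : ℝ ↦ softCoul η (x + t • e) y) (softCoulDeriv η e (x + t • e) y) t :=
  (hasDerivAt_inv_softDist hη e x y t).const_mul _

theorem hasDerivAt_softCoulDeriv {η : ℝ} (hη : 0 < η) {e : E3} (he : ‖e‖ = 1) (x y : E3) (t : ℝ) :
    HasDerivAt (fun t : ℝ ↦ softCoulDeriv η e (x + t • e) y)
      (softCoulDeriv2 η e (x + t • e) y) t := by
  have h := (((hasDerivAt_inner_line e x he y t).neg).mul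
    ((hasDerivAt_inv_softDist hη e x y t).pow 3)).const_mul (4 * π)⁻¹
  refine h.congr_deriv ?_
  simp only [softCoulDeriv2, Pi.neg_apply, Pi.pow_apply, Nat.cast_ofNat, Nat.add_one_sub_one]
  ring

/-- The regularised kernel is superharmonic. -/
theorem sum_softCoulDeriv2 {η : ℝ} (hη : 0 < η) (b : OrthonormalBasis (Fin 3) ℝ E3) (x y : E3) :
    ∑ i, softCoulDeriv2 η (b i) x y = -((4 * π)⁻¹ * (3 * η ^ 2 * (softDist η x y)⁻¹ ^ 5)) := by
  have h := b.sum_sq_inner_left (x - y)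
  have h0 := softDist_pos hη x y
  have h2 : (softDist η x y)⁻¹ ^ 3 = (‖x - y‖ ^ 2 + η ^ 2) * (softDist η x y)⁻¹ ^ 5 := by
    rw [← sq_softDist]; field_simp
  simp only [Fin.sum_univ_three] at h ⊢
  simp only [softCoulDeriv2]
  rw [h2, ← h]
  ring

theorem hasDerivAt_setIntegral_line {A : Set E3} (hA : volume A ≠ ⊤) {K K' : E3 → E3 → ℝ}
    {e : E3} {M M' : ℝ} (hK : Continuous (Function.uncurry K))
    (hK' : Continuous (Function.uncurry K')) (hM : ∀ x y, |K x y| ≤ M)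
    (hM' : ∀ x y, |K' x y| ≤ M')
    (hd : ∀ x y t, HasDerivAt (fun t : ℝ ↦ K (x + t • e) y) (K' (x + t • e) y) t) (x : E3) (t : ℝ) :
    HasDerivAt (fun t : ℝ ↦ ∫ y in A, K (x + t • e) y) (∫ y in A, K' (x + t • e) y) t := by
  have hfin : IsFiniteMeasure (volume.restrict A) := ⟨by simpa using hA.lt_top⟩
  have hc : ∀ x, Continuous (K x) := fun x ↦ hK.comp (by fun_prop : Continuous fun y ↦ (x, y))
  have hc' : ∀ x, Continuous (K' x) := fun x ↦ hK'.comp (by fun_prop : Continuous fun y ↦ (x, y))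
  refine (hasDerivAt_integral_of_dominated_loc_of_deriv_le (bound := fun _ ↦ M')
    (F := fun t y ↦ K (x + t • e) y) (F' := fun t y ↦ K' (x + t • e) y)
    univ_mem (Eventually.of_forall fun s ↦ (hc _).aestronglyMeasurable) ?_
    (hc' _).aestronglyMeasurable (Eventually.of_forall fun y s _ ↦ hM' _ _) (integrable_const _)
    (Eventually.of_forall fun y s _ ↦ hd x y s)).2
  exact Integrable.of_bound (C := M) (hc _).aestronglyMeasurable
    (Eventually.of_forall fun y ↦ hM _ _)

theorem integrableOn_softCoul {η : ℝ} (hη : 0 < η) {A : Set E3} (hA : volume A ≠ ⊤) (x : E3) :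
    IntegrableOn (softCoul η x) A := by
  have hfin : IsFiniteMeasure (volume.restrict A) := ⟨by simpa using hA.lt_top⟩
  exact Integrable.of_bound (C := η⁻¹) (((continuous_softCoul hη).comp
    (by fun_prop : Continuous fun y ↦ (x, y))).aestronglyMeasurable)
    (Eventually.of_forall fun y ↦ abs_softCoul_le hη x y)

theorem integrableOn_softCoulDeriv2 {η : ℝ} (hη : 0 < η) {e : E3} (he : ‖e‖ = 1)
    {A : Set E3} (hA : volume A ≠ ⊤) (x : E3) :
    IntegrableOn (softCoulDeriv2 η e x) A := by
  have hfin : IsFiniteMeasure (volume.restrict A) := ⟨by simpa using hA.lt_top⟩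
  exact Integrable.of_bound (C := 2 * η⁻¹ ^ 3) (((continuous_softCoulDeriv2 hη e).comp
    (by fun_prop : Continuous fun y ↦ (x, y))).aestronglyMeasurable)
    (Eventually.of_forall fun y ↦ abs_softCoulDeriv2_le hη he x y)

theorem continuous_integral_softCoul {η : ℝ} (hη : 0 < η) {A : Set E3} (hA : volume A ≠ ⊤) :
    Continuous fun x ↦ ∫ y in A, softCoul η x y := by
  have hfin : IsFiniteMeasure (volume.restrict A) := ⟨by simpa using hA.lt_top⟩
  refine continuous_of_dominated (bound := fun _ ↦ η⁻¹)
    (fun x ↦ (integrableOn_softCoul hη hA x).aestronglyMeasurable)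
    (fun x ↦ Eventually.of_forall fun y ↦ abs_softCoul_le hη x y) (integrable_const _)
    (Eventually.of_forall fun y ↦ ?_)
  have hpair : Continuous fun x : E3 ↦ (x, y) := by fun_prop
  have hcomp := (continuous_softCoul hη).comp hpair
  simpa only [Function.comp_def, Function.uncurry_apply_pair] using hcomp

/-- The regularised potentials converge uniformly. -/
theorem exists_abs_integral_softCoul_sub_le {A : Set E3} (hA : volume A ≠ ⊤) :
    ∃ D : ℝ, 0 ≤ D ∧ ∀ η : ℝ, 0 < η → ∀ x : E3,
      |(∫ y in A, softCoul η x y) - coulombPotential A x| ≤ D * η := by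
  obtain ⟨C, hC, h⟩ := exists_integral_inv_sq_le
  refine ⟨C + volume.real A, by positivity, fun η hη x ↦ ?_⟩
  have hs := integrableOn_softCoul hη hA x
  have hi := integrableOn_coul hA x
  rw [coulombPotential, ← integral_sub hs hi]
  calc |∫ y in A, (softCoul η x y - coul x y)| ≤ ∫ y in A, |softCoul η x y - coul x y| :=
        abs_integral_le_integral_abs
    _ ≤ ∫ y in A, η * ‖x - y‖⁻¹ ^ 2 := by
        refine integral_mono_ae (hs.sub hi).abs ((h x A hA).1.const_mul η) ?_
        filter_upwards [ae_restrict_ne A x] with y hy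
        have ha : 0 < ‖x - y‖ := norm_pos_iff.2 (sub_ne_zero.2 hy.symm)
        have h0 := softDist_pos hη x y
        have h1 := norm_le_softDist (η := η) x y
        have h2 : softDist η x y ≤ ‖x - y‖ + η :=
          sqrt_le_iff.2 ⟨by positivity, by nlinarith [mul_pos ha hη]⟩
        have e : softCoul η x y - coul x y = -((4 * π)⁻¹ *
            ((softDist η x y - ‖x - y‖) * (‖x - y‖⁻¹ * (softDist η x y)⁻¹))) := by
          simp only [softCoul, coul]; field_simp; ring
        rw [e, abs_neg, abs_of_nonneg (mul_nonneg (by positivity)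
          (mul_nonneg (by linarith) (by positivity)))]
        have h3 : (softDist η x y)⁻¹ ≤ ‖x - y‖⁻¹ := inv_anti₀ ha h1
        calc (4 * π)⁻¹ * ((softDist η x y - ‖x - y‖) * (‖x - y‖⁻¹ * (softDist η x y)⁻¹))
            ≤ 1 * (η * (‖x - y‖⁻¹ * ‖x - y‖⁻¹)) := by
              have : 0 ≤ softDist η x y - ‖x - y‖ := by linarith
              gcongr
              · linarith [four_pi_inv_le]
              · linarith
          _ = _ := by ring
    _ ≤ _ := by
        rw [integral_const_mul, mul_comm]
        gcongr
        exact (h x A hA).2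

/-- At a local minimum the second derivative is nonnegative. -/
theorem IsLocalMin.second_deriv_nonneg {g g' : ℝ → ℝ} {g'' a : ℝ} (hmin : IsLocalMin g a)
    (hg : ∀ t, HasDerivAt g (g' t) t) (hg' : HasDerivAt g' g'' a) : 0 ≤ g'' := by
  by_contra! hneg
  have hd : deriv g = g' := funext fun t ↦ (hg t).deriv
  have hmax : IsLocalMax g a := isLocalMax_of_deriv_deriv_neg (by rwa [hd, hg'.deriv])
    hmin.deriv_eq_zero (hg a).continuousAt
  have hconst : g =ᶠ[𝓝 a] fun _ ↦ g a := by
    filter_upwards [hmin, hmax] with t h1 h2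
    exact le_antisymm h2 h1
  have h1 : deriv g =ᶠ[𝓝 a] fun _ ↦ 0 := by
    have := hconst.deriv
    simpa using this
  have h2 := h1.deriv_eq
  rw [hd, hg'.deriv] at h2
  simp at h2
  exact hneg.ne h2

/-- Maximum principle: if the negative charge avoids the region where the potential is negative,
the potential is nowhere negative. -/
theorem coulombPotential_le_of_null {P N : Set E3} (hmN : MeasurableSet N)
    (hP : volume P ≠ ⊤) (hN : volume N ≠ ⊤)
    (hnull : volume (N ∩ {x | coulombPotential P x < coulombPotential N x}) = 0) (x : E3) :
    coulombPotential N x ≤ coulombPotential P x := by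
  by_contra! hx
  set m := coulombPotential N x - coulombPotential P x with hm
  have hm0 : 0 < m := sub_pos.2 hx
  obtain ⟨R, hR, hdecay⟩ := exists_coulombPotential_le_of_norm_ge hmN hN
    (by positivity : 0 < m / 4)
  have hxR : ‖x‖ < R := by
    by_contra! h
    linarith [hdecay x h, coulombPotential_nonneg P x]
  set ε := m / (16 * R ^ 2) with hε
  have hε0 : 0 < ε := by positivity
  have hεR : ε * R ^ 2 = m / 16 := by rw [hε]; field_simp
  obtain ⟨LP, hLP, hlipP⟩ := exists_lipschitz_coulombPotential hP
  obtain ⟨LN, hLN, hlipN⟩ := exists_lipschitz_coulombPotential hN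
  set r := m / (4 * (LP + LN + 1)) with hr
  have hr0 : 0 < r := by positivity
  have hLr : (LP + LN) * r ≤ m / 4 := by
    have : (LP + LN + 1) * r = m / 4 := by rw [hr]; field_simp
    linarith
  obtain ⟨DP, hDP, happP⟩ := exists_abs_integral_softCoul_sub_le hP
  obtain ⟨DN, hDN, happN⟩ := exists_abs_integral_softCoul_sub_le hN
  obtain ⟨η, hη, hη1, hη2⟩ : ∃ η : ℝ, 0 < η ∧ (DP + DN) * η < m / 16 ∧
      η ^ 2 * (r⁻¹ ^ 5 * volume.real N) < 6 * ε := by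
    have h1 : Tendsto (fun η : ℝ ↦ (DP + DN) * η) (𝓝[>] 0) (𝓝 0) := by
      have : Continuous (fun η : ℝ ↦ (DP + DN) * η) := by fun_prop
      simpa using (this.tendsto 0).mono_left nhdsWithin_le_nhds
    have h2 : Tendsto (fun η : ℝ ↦ η ^ 2 * (r⁻¹ ^ 5 * volume.real N)) (𝓝[>] 0) (𝓝 0) := by
      have : Continuous (fun η : ℝ ↦ η ^ 2 * (r⁻¹ ^ 5 * volume.real N)) := by fun_prop
      simpa using (this.tendsto 0).mono_left nhdsWithin_le_nhds
    have h0 : ∀ᶠ η : ℝ in 𝓝[>] 0, 0 < η := self_mem_nhdsWithin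
    exact (h0.and ((h1.eventually_lt_const (by positivity : 0 < m / 16)).and
      (h2.eventually_lt_const (by positivity : 0 < 6 * ε)))).exists
  set v : E3 → ℝ := fun z ↦
    (∫ y in P, softCoul η z y) - (∫ y in N, softCoul η z y) - ε * ‖z‖ ^ 2 with hv
  have hvc : Continuous v := by
    have h1 := continuous_integral_softCoul hη hP
    have h2 := continuous_integral_softCoul hη hN
    have h3 : Continuous fun z : E3 ↦ ε * ‖z‖ ^ 2 := by fun_prop
    exact (h1.sub h2).sub h3
  have hvapp : ∀ z, |v z + ε * ‖z‖ ^ 2 - (coulombPotential P z - coulombPotential N z)|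
      ≤ m / 16 := by
    intro z
    have h1 := abs_le.1 (happP η hη z)
    have h2 := abs_le.1 (happN η hη z)
    rw [abs_le]
    simp only [hv]
    constructor <;> linarith
  obtain ⟨z, hzR, hzmin⟩ := (isCompact_closedBall (0 : E3) R).exists_isMinOn
    ⟨0, by simp [hR.le]⟩ hvc.continuousOn
  have hzR' : ‖z‖ ≤ R := by simpa using hzR
  have hvx : v z ≤ -m + m / 16 := by
    have h1 : v z ≤ v x := hzmin (by simpa using hxR.le)
    have h2 := abs_le.1 (hvapp x)
    have h3 : 0 ≤ ε * ‖x‖ ^ 2 := by positivity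
    linarith
  have hεz : ε * ‖z‖ ^ 2 ≤ m / 16 := by rw [← hεR]; gcongr
  have hvz := abs_le.1 (hvapp z)
  have hzlt : ‖z‖ < R := by
    by_contra! h
    linarith [hdecay z h, coulombPotential_nonneg P z]
  have hfar : ∀ᵐ y ∂(volume.restrict N), r ≤ ‖z - y‖ := by
    rw [ae_iff, Measure.restrict_apply' hmN]
    refine measure_mono_null ?_ hnull
    rintro y ⟨hy, hyN⟩
    refine ⟨hyN, ?_⟩
    have hy' : ‖z - y‖ < r := not_le.1 hy
    have h1 := abs_le.1 (hlipP z y)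
    have h2 := abs_le.1 (hlipN z y)
    have h3 : (LP + LN) * ‖z - y‖ ≤ (LP + LN) * r := by gcongr
    change coulombPotential P y < coulombPotential N y
    linarith
  set b := EuclideanSpace.basisFun (Fin 3) ℝ
  have hsecond : ∀ i, 0 ≤ (∫ y in P, softCoulDeriv2 η (b i) z y)
      - (∫ y in N, softCoulDeriv2 η (b i) z y) - 2 * ε := by
    intro i
    have he : ‖b i‖ = 1 := b.orthonormal.1 i
    have hD : ∀ {A : Set E3}, volume A ≠ ⊤ → ∀ t : ℝ,
        HasDerivAt (fun t : ℝ ↦ ∫ y in A, softCoul η (z + t • b i) y)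
          (∫ y in A, softCoulDeriv η (b i) (z + t • b i) y) t := fun hA ↦
      hasDerivAt_setIntegral_line hA (continuous_softCoul hη) (continuous_softCoulDeriv hη _)
        (abs_softCoul_le hη) (abs_softCoulDeriv_le hη he) (hasDerivAt_softCoul hη _) z
    have hD' : ∀ {A : Set E3}, volume A ≠ ⊤ → ∀ t : ℝ,
        HasDerivAt (fun t : ℝ ↦ ∫ y in A, softCoulDeriv η (b i) (z + t • b i) y)
          (∫ y in A, softCoulDeriv2 η (b i) (z + t • b i) y) t := fun hA ↦
      hasDerivAt_setIntegral_line hA (continuous_softCoulDeriv hη _)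
        (continuous_softCoulDeriv2 hη _) (abs_softCoulDeriv_le hη he)
        (abs_softCoulDeriv2_le hη he) (hasDerivAt_softCoulDeriv hη he) z
    have hg : ∀ t : ℝ, HasDerivAt (fun t : ℝ ↦ v (z + t • b i))
        ((∫ y in P, softCoulDeriv η (b i) (z + t • b i) y)
          - (∫ y in N, softCoulDeriv η (b i) (z + t • b i) y)
          - ε * (2 * inner ℝ (z + t • b i) (b i))) t := fun t ↦
      ((hD hP t).sub (hD hN t)).sub ((hasDerivAt_line (b i) z t).norm_sq.const_mul ε)
    have hg' := ((hD' hP 0).sub (hD' hN 0)).sub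
      (((hasDerivAt_inner_line (b i) z he 0 0).const_mul 2).const_mul ε)
    simp only [sub_zero] at hg'
    have hmin : IsLocalMin (fun t : ℝ ↦ v (z + t • b i)) 0 := by
      have hc : Continuous fun t : ℝ ↦ z + t • b i := by fun_prop
      have hopen : ∀ᶠ t : ℝ in 𝓝 0, z + t • b i ∈ Metric.ball (0 : E3) R :=
        hc.continuousAt.eventually (Metric.isOpen_ball.mem_nhds (by simpa using hzlt))
      filter_upwards [hopen] with t ht
      simp only [zero_smul, add_zero]
      exact hzmin (Metric.ball_subset_closedBall ht)
    have := hmin.second_deriv_nonneg hg hg'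
    simp only [zero_smul, add_zero] at this
    linarith
  have hsumint : ∀ {A : Set E3}, volume A ≠ ⊤ →
      ∑ i, ∫ y in A, softCoulDeriv2 η (b i) z y
        = -∫ y in A, (4 * π)⁻¹ * (3 * η ^ 2 * (softDist η z y)⁻¹ ^ 5) := by
    intro A hA
    rw [← integral_finsetSum _ fun i _ ↦
      integrableOn_softCoulDeriv2 hη (b.orthonormal.1 i) hA z, ← integral_neg]
    simp_rw [sum_softCoulDeriv2 hη b]
  have hsum := Finset.sum_nonneg fun i (_ : i ∈ Finset.univ) ↦ hsecond i
  rw [Finset.sum_sub_distrib, Finset.sum_sub_distrib, hsumint hP, hsumint hN] at hsum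
  have hPpos : 0 ≤ ∫ y in P, (4 * π)⁻¹ * (3 * η ^ 2 * (softDist η z y)⁻¹ ^ 5) :=
    integral_nonneg fun y ↦ by
      have := softDist_pos hη z y
      positivity
  have hfinN : IsFiniteMeasure (volume.restrict N) := ⟨by simpa using hN.lt_top⟩
  have hNle : ∫ y in N, (4 * π)⁻¹ * (3 * η ^ 2 * (softDist η z y)⁻¹ ^ 5)
      ≤ η ^ 2 * (r⁻¹ ^ 5 * volume.real N) := by
    calc ∫ y in N, (4 * π)⁻¹ * (3 * η ^ 2 * (softDist η z y)⁻¹ ^ 5)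
        ≤ ∫ y in N, η ^ 2 * r⁻¹ ^ 5 := by
          refine integral_mono_of_nonneg (Eventually.of_forall fun y ↦ ?_) (integrable_const _) ?_
          · have := softDist_pos hη z y
            simp only [Pi.zero_apply]
            positivity
          · filter_upwards [hfar] with y hy
            have h0 := softDist_pos hη z y
            have h1 : (softDist η z y)⁻¹ ≤ r⁻¹ := inv_anti₀ hr0 (hy.trans (norm_le_softDist z y))
            calc (4 * π)⁻¹ * (3 * η ^ 2 * (softDist η z y)⁻¹ ^ 5)
                ≤ 1 / 3 * (3 * η ^ 2 * r⁻¹ ^ 5) := by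
                  gcongr
                  exact four_pi_inv_le
              _ = _ := by ring
      _ = _ := by simp [measureReal_def]; ring
  simp only [Finset.sum_const, Finset.card_univ, Fintype.card_fin, nsmul_eq_mul] at hsum
  push_cast at hsum
  linarith

theorem coulombPotential_ball_smul {R : ℝ} (hR : 0 < R) (x : E3) :
    coulombPotential (Metric.ball 0 R) (R • x) = R ^ 2 * coulombPotential (Metric.ball 0 1) x := by
  have h := Measure.setIntegral_comp_smul_of_pos volume (fun z ↦ coul (R • x) z)
    (Metric.ball (0 : E3) 1) hR
  have hs : ∀ z : E3, coul (R • x) (R • z) = R⁻¹ * coul x z := by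
    intro z
    rw [coul, coul, ← smul_sub, norm_smul, norm_of_nonneg hR.le]
    simp only [one_div, mul_inv]
    ring
  simp_rw [hs] at h
  rw [integral_const_mul, smul_ball hR.ne', smul_zero, norm_of_nonneg hR.le, mul_one] at h
  simp only [finrank_euclideanSpace, Fintype.card_fin, smul_eq_mul] at h
  have h' : R⁻¹ * coulombPotential (Metric.ball 0 1) x
      = (R ^ 3)⁻¹ * coulombPotential (Metric.ball 0 R) (R • x) := h
  field_simp at h'
  linarith

theorem coulombPotential_unitBall_zero_pos :
    0 < coulombPotential (Metric.ball (0 : E3) 1) 0 := by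
  have hfin : volume (Metric.ball (0 : E3) 1) ≠ ⊤ := measure_ball_lt_top.ne
  have hv : 0 < volume.real (Metric.ball (0 : E3) 1) :=
    ENNReal.toReal_pos (Metric.measure_ball_pos _ _ one_pos).ne' hfin
  have hf : IsFiniteMeasure (volume.restrict (Metric.ball (0 : E3) 1)) :=
    ⟨by simp⟩
  have hle : ∫ y in Metric.ball (0 : E3) 1, (4 * π)⁻¹ ≤ coulombPotential (Metric.ball 0 1) 0 := by
    refine integral_mono_ae (integrable_const _) (integrableOn_coul hfin 0) ?_
    filter_upwards [ae_restrict_ne (Metric.ball (0 : E3) 1) 0,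
      ae_restrict_mem measurableSet_ball] with y hy hy1
    have h1 : ‖y‖ < 1 := by simpa using hy1
    have h0 : 0 < ‖y‖ := norm_pos_iff.2 hy
    rw [coul, one_div, zero_sub, norm_neg]
    apply inv_anti₀ (by positivity)
    nlinarith [pi_pos]
  refine lt_of_lt_of_le ?_ hle
  simp only [integral_const, smul_eq_mul, measureReal_restrict_apply_univ]
  positivity

/-- If one potential dominates another everywhere, then so do the total charges. -/
theorem volume_le_of_coulombPotential_le {P N : Set E3} (hP : volume P ≠ ⊤) (hN : volume N ≠ ⊤)
    (h : ∀ x, coulombPotential N x ≤ coulombPotential P x) : volume N ≤ volume P := by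
  have hB : ∀ R : ℝ, volume (Metric.ball (0 : E3) R) ≠ ⊤ := fun R ↦ measure_ball_lt_top.ne
  set u : E3 → ℝ := coulombPotential (Metric.ball 0 1) with hu
  have huc : Continuous u := continuous_coulombPotential (hB 1)
  obtain ⟨M, hM⟩ := exists_coulombPotential_bound (hB 1)
  have hle : ∀ n : ℕ, ∫ y in N, u (((n : ℝ) + 1)⁻¹ • y) ≤ ∫ y in P, u (((n : ℝ) + 1)⁻¹ • y) := by
    intro n
    set R : ℝ := (n : ℝ) + 1
    have hR : 0 < R := by positivity
    have hs : ∀ A : Set E3, ∫ y in A, coulombPotential (Metric.ball 0 R) y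
        = R ^ 2 * ∫ y in A, u (R⁻¹ • y) := by
      intro A
      rw [← integral_const_mul]
      refine integral_congr_ae (Eventually.of_forall fun y ↦ ?_)
      simp only
      rw [← coulombPotential_ball_smul hR, smul_inv_smul₀ hR.ne']
    have hmono : ∫ x in Metric.ball (0 : E3) R, coulombPotential N x
        ≤ ∫ x in Metric.ball (0 : E3) R, coulombPotential P x :=
      integral_mono (integrableOn_coulombPotential hN (hB R))
        (integrableOn_coulombPotential hP (hB R)) h
    rw [integral_coulombPotential_comm (hB R) hN, integral_coulombPotential_comm (hB R) hP,
      hs, hs] at hmono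
    exact le_of_mul_le_mul_left hmono (by positivity)
  have hlim : ∀ A : Set E3, volume A ≠ ⊤ →
      Tendsto (fun n : ℕ ↦ ∫ y in A, u (((n : ℝ) + 1)⁻¹ • y)) atTop
        (𝓝 (volume.real A * u 0)) := by
    intro A hA
    have hfA : IsFiniteMeasure (volume.restrict A) := ⟨by simpa using hA.lt_top⟩
    have hc : ∫ _ in A, u 0 = volume.real A * u 0 := by simp [measureReal_def]
    rw [← hc]
    refine tendsto_integral_of_dominated_convergence (fun _ ↦ M)
      (fun n ↦ (huc.comp (by fun_prop)).aestronglyMeasurable) (integrable_const _)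
      (fun n ↦ Eventually.of_forall fun y ↦ ?_) (Eventually.of_forall fun y ↦ ?_)
    · rw [norm_of_nonneg (coulombPotential_nonneg _ _)]
      exact hM _
    · refine (huc.tendsto 0).comp ?_
      have := (tendsto_inv_atTop_zero.comp
        (tendsto_atTop_add_const_right _ (1 : ℝ) tendsto_natCast_atTop_atTop)).smul_const y
      simpa [Function.comp_def] using this
  have hfinal := le_of_tendsto_of_tendsto' (hlim N hN) (hlim P hP) hle
  have := le_of_mul_le_mul_right hfinal coulombPotential_unitBall_zero_pos
  exact (ENNReal.toReal_le_toReal hN hP).1 this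

theorem integral_coulombPotential_union_left {A B C : Set E3} (hA : volume A ≠ ⊤)
    (hB : volume B ≠ ⊤) (hC : volume C ≠ ⊤) (hd : Disjoint A B) (hmB : MeasurableSet B) :
    ∫ x in A ∪ B, coulombPotential C x
      = (∫ x in A, coulombPotential C x) + ∫ x in B, coulombPotential C x :=
  setIntegral_union hd hmB (integrableOn_coulombPotential hC hA)
    (integrableOn_coulombPotential hC hB)

theorem integral_coulombPotential_union_right {A B C : Set E3} (hA : volume A ≠ ⊤)
    (hB : volume B ≠ ⊤) (hC : volume C ≠ ⊤) (hd : Disjoint A B) (hmB : MeasurableSet B) :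
    ∫ x in C, coulombPotential (A ∪ B) x
      = (∫ x in C, coulombPotential A x) + ∫ x in C, coulombPotential B x := by
  simp_rw [coulombPotential_union hA hB hd hmB]
  exact integral_add (integrableOn_coulombPotential hA hC) (integrableOn_coulombPotential hB hC)

/-- The energy of `M ∪ A` against a disjointly decomposed configuration. -/
theorem energy_union {P M A : Set E3} (hP : volume P ≠ ⊤) (hM : volume M ≠ ⊤)
    (hA : volume A ≠ ⊤) (hd : Disjoint M A) (hmA : MeasurableSet A) :
    energy P (M ∪ A) = energy P M + (∫ x in A, coulombPotential A x)
      + 2 * (∫ x in A, coulombPotential M x) - 2 * ∫ x in A, coulombPotential P x := by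
  have hMA : volume (M ∪ A) ≠ ⊤ := measure_union_ne_top hM hA
  change (∫ x in P, coulombPotential P x) + (∫ x in M ∪ A, coulombPotential (M ∪ A) x)
      - 2 * (∫ x in P, coulombPotential (M ∪ A) x)
    = (∫ x in P, coulombPotential P x) + (∫ x in M, coulombPotential M x)
      - 2 * (∫ x in P, coulombPotential M x) + _ + _ - _
  rw [integral_coulombPotential_union_left hM hA hMA hd hmA,
    integral_coulombPotential_union_right hM hA hM hd hmA,
    integral_coulombPotential_union_right hM hA hA hd hmA,
    integral_coulombPotential_union_right hM hA hP hd hmA,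
    integral_coulombPotential_comm hM hA, integral_coulombPotential_comm hP hA]
  ring

/-- **Theorem 2.2(2)** (The constrained problem: nonexistence for `λ > |Ω⁺|`):
every admissible configuration can be strictly improved, so there is no global
minimizer. -/
theorem constrained_nonexistence
    (Ωp : Set E3) (hne : Ωp.Nonempty) (ho : IsOpen Ωp) (hb : Bornology.IsBounded Ωp)
    (lam : ℝ) (hgt : volume Ωp < ENNReal.ofReal lam) :
    ∀ Ωm, AdmC Ωp lam Ωm → ∃ Ωm', AdmC Ωp lam Ωm' ∧ energy Ωp Ωm' < energy Ωp Ωm := by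
  rintro N ⟨hmN, hPN, hvN⟩
  have hP : volume Ωp ≠ ⊤ := hgt.ne_top
  have hN : volume N ≠ ⊤ := by rw [hvN]; exact ENNReal.ofReal_ne_top
  have hcP := continuous_coulombPotential hP
  have hcN := continuous_coulombPotential hN
  obtain ⟨δ, hδ, hS⟩ : ∃ δ : ℝ, 0 < δ ∧
      volume (N ∩ {x | coulombPotential Ωp x + δ ≤ coulombPotential N x}) ≠ 0 := by
    by_contra! hcon
    refine hgt.not_ge (hvN ▸ volume_le_of_coulombPotential_le hP hN
      (coulombPotential_le_of_null hmN hP hN ?_))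
    refine measure_mono_null (t := ⋃ n : ℕ, N ∩ {x | coulombPotential Ωp x + 1 / ((n : ℝ) + 1)
      ≤ coulombPotential N x}) ?_ (measure_iUnion_null fun n ↦ hcon _ (by positivity))
    rintro x ⟨hxN, hx⟩
    have hx' : 0 < coulombPotential N x - coulombPotential Ωp x := sub_pos.2 hx
    obtain ⟨n, hn⟩ := exists_nat_one_div_lt hx'
    exact mem_iUnion.2 ⟨n, hxN, by simp only [mem_ofPred_eq]; linarith⟩
  set S := N ∩ {x | coulombPotential Ωp x + δ ≤ coulombPotential N x}
  have hmS : MeasurableSet S :=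
    hmN.inter (isClosed_le (hcP.add continuous_const) hcN).measurableSet
  have hSfin : volume S ≠ ⊤ := ne_top_of_le_ne_top hN (measure_mono inter_subset_left)
  obtain ⟨a₀, ha₀, hsmall⟩ := exists_coulombPotential_lt (by positivity : 0 < δ / 4)
  have hSpos : 0 < volume.real S := ENNReal.toReal_pos hS hSfin
  set a := min a₀ (volume.real S / 2) with ha
  have hapos : 0 < a := by positivity
  have haS : ENNReal.ofReal a < volume S := by
    rw [ENNReal.ofReal_lt_iff_lt_toReal hapos.le hSfin]
    exact (min_le_right _ _).trans_lt (half_lt_self hSpos)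
  have haa₀ : ENNReal.ofReal a ≤ ENNReal.ofReal a₀ := ENNReal.ofReal_le_ofReal (min_le_left _ _)
  obtain ⟨A, hAS, hmA, hvA⟩ := exists_measurable_subset_volume_eq hmS hapos.le haS
  obtain ⟨R, hR, hdecay⟩ := exists_coulombPotential_le_of_norm_ge hmN hN
    (by positivity : 0 < δ / 4)
  set U := Ωp ∪ N ∪ Metric.ball (0 : E3) R
  have hmU : MeasurableSet U := (ho.measurableSet.union hmN).union measurableSet_ball
  have hU : volume U ≠ ⊤ :=
    measure_union_ne_top (measure_union_ne_top hP hN) measure_ball_lt_top.ne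
  have hUc : volume Uᶜ = ⊤ := by
    by_contra hne'
    have := measure_union_ne_top hU hne'
    rw [union_compl_self] at this
    exact this (measure_univ_of_isAddLeftInvariant _)
  obtain ⟨B, hBU, hmB, hvB⟩ := exists_measurable_subset_volume_eq hmU.compl hapos.le
    (by rw [hUc]; exact ENNReal.ofReal_lt_top)
  have hBP : Disjoint Ωp B := disjoint_left.2 fun x hx hxB ↦ hBU hxB (Or.inl (Or.inl hx))
  have hBN : Disjoint N B := disjoint_left.2 fun x hx hxB ↦ hBU hxB (Or.inl (Or.inr hx))
  have hBR : ∀ x ∈ B, R ≤ ‖x‖ := by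
    intro x hx
    by_contra! hlt
    exact hBU hx (Or.inr (by simpa using hlt))
  have hAN : A ⊆ N := hAS.trans inter_subset_left
  have hA : volume A ≠ ⊤ := by rw [hvA]; exact ENNReal.ofReal_ne_top
  have hB : volume B ≠ ⊤ := by rw [hvB]; exact ENNReal.ofReal_ne_top
  have hM : volume (N \ A) ≠ ⊤ := ne_top_of_le_ne_top hN (measure_mono sdiff_subset)
  have hMB : Disjoint (N \ A) B := hBN.mono_left sdiff_subset
  have hMA : Disjoint (N \ A) A := disjoint_sdiff_left
  have hNunion : N \ A ∪ A = N := sdiff_union_of_subset hAN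
  refine ⟨N \ A ∪ B, ⟨(hmN.diff hmA).union hmB, ?_, ?_⟩, ?_⟩
  · rw [inter_union_distrib_left, hBP.inter_eq, union_empty]
    exact measure_mono_null (inter_subset_inter_right _ sdiff_subset) hPN
  · rw [measure_union hMB hmB, hvB, ← hvA, ← measure_union hMA hmA, hNunion, hvN]
  have hEB := energy_union hP hM hB hMB hmB
  have hEA := energy_union hP hM hA hMA hmA
  rw [hNunion] at hEA
  have hA1 := integral_coulombPotential_union_right hM hA hA hMA hmA
  have hB1 := integral_coulombPotential_union_right hM hA hB hMA hmA
  rw [hNunion] at hA1 hB1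
  have hra : ∀ {D : Set E3}, volume D = ENNReal.ofReal a → volume.real D = a := fun h ↦ by
    rw [measureReal_def, h, ENNReal.toReal_ofReal hapos.le]
  have hself : ∀ {D : Set E3} (κ : ℝ), MeasurableSet D → volume D = ENNReal.ofReal a →
      ∀ {f : E3 → ℝ}, IntegrableOn f D → (∀ x ∈ D, f x ≤ κ) → ∫ x in D, f x ≤ κ * a := by
    intro D κ hmD hD f hf hle
    have hDfin : IsFiniteMeasure (volume.restrict D) := ⟨by simp [hD]⟩
    calc ∫ x in D, f x ≤ ∫ _ in D, κ := setIntegral_mono_on hf (integrable_const _) hmD hle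
      _ = κ * a := by
        simp only [integral_const, smul_eq_mul, measureReal_restrict_apply_univ, hra hD]
        ring
  have h1 := hself (δ / 4) hmB hvB (integrableOn_coulombPotential hB hB)
    fun x _ ↦ hsmall x B (hvB.trans_le haa₀)
  have h2 := hself (δ / 4) hmB hvB (integrableOn_coulombPotential hN hB)
    fun x hx ↦ hdecay x (hBR x hx)
  have h3 := hself (δ / 4) hmA hvA (integrableOn_coulombPotential hA hA)
    fun x _ ↦ hsmall x A (hvA.trans_le haa₀)
  have h4 := hself (-δ) hmA hvA
    ((integrableOn_coulombPotential hP hA).sub (integrableOn_coulombPotential hN hA))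
    fun x hx ↦ by
      have : coulombPotential Ωp x + δ ≤ coulombPotential N x := (hAS hx).2
      simp only [Pi.sub_apply]
      linarith
  simp only [Pi.sub_apply] at h4
  rw [integral_sub (integrableOn_coulombPotential hP hA) (integrableOn_coulombPotential hN hA)]
    at h4
  have h5 : 0 ≤ ∫ x in B, coulombPotential A x := integral_nonneg (coulombPotential_nonneg A)
  have h6 : 0 ≤ ∫ x in B, coulombPotential Ωp x := integral_nonneg (coulombPotential_nonneg Ωp)
  have h7 : 0 < δ * a := by positivity
  linarith
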